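/- arXiv:1710.07905 — 2 statements merged into one kernel-verified Lean document; each statement's English description precedes it below -/
import Mathlib

section
/- (Pointwise continuity bound for the compliance tensor, the pointwise form of the continuity estimate (3.14) in Theorem 3.2) For all d×d real matrices σ and τ, |⟨𝒜σ, τ⟩| ≤ (1/(2μ))·‖σ‖·‖τ‖. -/
open Matrix

/-- Frobenius inner product of `d × d` real matrices: `⟨A,B⟩ = tr (Aᵀ * B)`. -/
noncomputable def frob {d : ℕ} (A B : Matrix (Fin d) (Fin d) ℝ) : ℝ :=
  (Aᵀ * B).trace

/-- Frobenius norm of a `d × d` real matrix. -/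
noncomputable def frobNorm {d : ℕ} (A : Matrix (Fin d) (Fin d) ℝ) : ℝ :=
  Real.sqrt (frob A A)

/-- Deviatoric part of a matrix: `τ_D = τ - (1/d) (tr τ) I`. -/
noncomputable def dev {d : ℕ} (τ : Matrix (Fin d) (Fin d) ℝ) : Matrix (Fin d) (Fin d) ℝ :=
  τ - (1 / (d : ℝ)) • τ.trace • (1 : Matrix (Fin d) (Fin d) ℝ)

/-- Compliance tensor: `𝒜σ = (1/(2μ)) (σ - (λ/(2μ+dλ)) (tr σ) I)`. -/
noncomputable def compliance {d : ℕ} (μ lam : ℝ) (σ : Matrix (Fin d) (Fin d) ℝ) :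
    Matrix (Fin d) (Fin d) ℝ :=
  (1 / (2 * μ)) •
    (σ - (lam / (2 * μ + (d : ℝ) * lam)) • σ.trace • (1 : Matrix (Fin d) (Fin d) ℝ))

theorem frob_eq_sum {d : ℕ} (A B : Matrix (Fin d) (Fin d) ℝ) :
    frob A B = ∑ p : Fin d × Fin d, A p.1 p.2 * B p.1 p.2 := by
  rw [Fintype.sum_prod_type_right]
  simp [frob, Matrix.trace, Matrix.mul_apply]

theorem frob_self_nonneg {d : ℕ} (A : Matrix (Fin d) (Fin d) ℝ) : 0 ≤ frob A A := by
  rw [frob_eq_sum]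
  exact Finset.sum_nonneg fun p _ => mul_self_nonneg _

/-- Cauchy-Schwarz inequality for the Frobenius inner product. -/
theorem abs_frob_le {d : ℕ} (A B : Matrix (Fin d) (Fin d) ℝ) :
    |frob A B| ≤ frobNorm A * frobNorm B := by
  rw [frobNorm, frobNorm, ← Real.sqrt_mul (frob_self_nonneg A)]
  refine Real.abs_le_sqrt ?_
  simp only [frob_eq_sum, ← pow_two]
  exact Finset.sum_mul_sq_le_sq_mul_sq _ _ _

theorem frob_smul_left {d : ℕ} (a : ℝ) (A B : Matrix (Fin d) (Fin d) ℝ) :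
    frob (a • A) B = a * frob A B := by
  simp [frob]

theorem frob_sub_trace_smul_one_self {d : ℕ} (c : ℝ) (σ : Matrix (Fin d) (Fin d) ℝ) :
    frob (σ - c • σ.trace • (1 : Matrix (Fin d) (Fin d) ℝ))
      (σ - c • σ.trace • (1 : Matrix (Fin d) (Fin d) ℝ)) =
      frob σ σ - c * (2 - d * c) * σ.trace ^ 2 := by
  simp [frob, Matrix.sub_mul, Matrix.mul_sub, Matrix.trace_sub, Matrix.trace_smul]
  ring

/-- Subtracting a multiple of the trace part does not increase the Frobenius norm, as long as the
multiple lies between the identity and the reflection through the deviatoric part. -/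
theorem frobNorm_sub_trace_smul_one_le {d : ℕ} {c : ℝ} (hc : 0 ≤ c) (hdc : d * c ≤ 2)
    (σ : Matrix (Fin d) (Fin d) ℝ) :
    frobNorm (σ - c • σ.trace • (1 : Matrix (Fin d) (Fin d) ℝ)) ≤ frobNorm σ := by
  refine Real.sqrt_le_sqrt ?_
  rw [frob_sub_trace_smul_one_self]
  have := mul_nonneg (mul_nonneg hc (sub_nonneg.2 hdc)) (sq_nonneg σ.trace)
  linarith

/-- Pointwise continuity bound for the compliance tensor:
`|⟨𝒜σ, τ⟩| ≤ (1/(2μ)) ‖σ‖ ‖τ‖`. -/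
theorem compliance_inner_le {d : ℕ} (hd : 1 ≤ d) {μ lam : ℝ} (hμ : 0 < μ) (hlam : 0 < lam)
    (σ τ : Matrix (Fin d) (Fin d) ℝ) :
    |frob (compliance μ lam σ) τ| ≤ (1 / (2 * μ)) * frobNorm σ * frobNorm τ := by
  have hden : 0 < 2 * μ + (d : ℝ) * lam := by positivity
  have hdc : (d : ℝ) * (lam / (2 * μ + (d : ℝ) * lam)) ≤ 2 := by
    rw [← mul_div_assoc, div_le_iff₀ hden]
    have : 0 ≤ (d : ℝ) * lam := by positivity
    linarith
  rw [compliance, frob_smul_left, abs_mul, abs_of_pos (by positivity : 0 < 1 / (2 * μ)), mul_assoc]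
  refine mul_le_mul_of_nonneg_left ((abs_frob_le _ _).trans ?_) (by positivity)
  exact mul_le_mul_of_nonneg_right
    (frobNorm_sub_trace_smul_one_le (by positivity) hdc σ) (Real.sqrt_nonneg _)
end

section
/- (λ-uniform pointwise coercivity identity, the pointwise core of the robust coercivity estimate in Theorem 3.2) For every d×d real matrix σ, ‖σ‖² = 2μ·⟨𝒜σ, σ⟩ + (λ/(dλ+2μ))·(tr σ)². Consequently ‖σ‖² ≤ 2μ·⟨𝒜σ, σ⟩ + (1/d)·(tr σ)², an estimate whose constants are independent of the Lamé constant λ. -/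
open Matrix

theorem frobNorm_sq {d : ℕ} (A : Matrix (Fin d) (Fin d) ℝ) : frobNorm A ^ 2 = frob A A :=
  Real.sq_sqrt (frob_self_nonneg A)

theorem frob_compliance {d : ℕ} (μ lam : ℝ) (σ τ : Matrix (Fin d) (Fin d) ℝ) :
    frob (compliance μ lam σ) τ
      = 1 / (2 * μ)
        * (frob σ τ - lam / (2 * μ + (d : ℝ) * lam) * (σ.trace * τ.trace)) := by
  simp [frob, compliance, Matrix.sub_mul, Matrix.trace_sub, Matrix.trace_smul]

/-- λ-uniform pointwise coercivity identity:
`‖σ‖² = 2μ ⟨𝒜σ, σ⟩ + (λ/(dλ+2μ)) (tr σ)²`, whence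
`‖σ‖² ≤ 2μ ⟨𝒜σ, σ⟩ + (1/d) (tr σ)²` with constants independent of `λ`. -/
theorem compliance_coercivity_identity {d : ℕ} (hd : 1 ≤ d) {μ lam : ℝ}
    (hμ : 0 < μ) (hlam : 0 < lam) (σ : Matrix (Fin d) (Fin d) ℝ) :
    frobNorm σ ^ 2
      = 2 * μ * frob (compliance μ lam σ) σ
        + (lam / ((d : ℝ) * lam + 2 * μ)) * σ.trace ^ 2
    ∧ frobNorm σ ^ 2
      ≤ 2 * μ * frob (compliance μ lam σ) σ + (1 / (d : ℝ)) * σ.trace ^ 2 := by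
  have hd' : (0 : ℝ) < d := by exact_mod_cast hd
  have identity : frobNorm σ ^ 2
      = 2 * μ * frob (compliance μ lam σ) σ
        + (lam / ((d : ℝ) * lam + 2 * μ)) * σ.trace ^ 2 := by
    rw [frobNorm_sq, frob_compliance, add_comm (2 * μ) ((d : ℝ) * lam)]
    field_simp
    ring
  refine ⟨identity, identity.trans_le ?_⟩
  gcongr 2 * μ * frob (compliance μ lam σ) σ + ?_ * σ.trace ^ 2
  rw [div_le_div_iff₀ (by positivity) hd']
  linarith
end
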